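/- There is an absolute constant C > 0 such that for any n-dimensional closed Riemannian manifold M of nonnegative Ricci curvature and any k ≥ 1, λ_k(M) ≤ C·(k/(ωₙ·vol M))^(2/n). -/

import Mathlib

open MeasureTheory Metric Set

/-- Local slope (local Lipschitz constant) of `f` at `x`. On a Riemannian manifold
this equals `‖∇f(x)‖` for smooth `f`. -/
noncomputable def localSlope {X : Type} [MetricSpace X] (f : X → ℝ) (x : X) : ℝ :=
  Filter.limsup (fun y => |f y - f x| / dist y x) (nhdsWithin x {x}ᶜ)

/-- Rayleigh quotient of `f` on `Ω` with respect to the measure `μ`, using the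
local slope as the norm of the gradient. -/
noncomputable def mmRayleigh {X : Type} [MetricSpace X] [MeasurableSpace X] (μ : Measure X) (Ω : Set X)
    (f : X → ℝ) : ℝ :=
  (∫ x in Ω, (localSlope f x) ^ 2 ∂μ) / (∫ x in Ω, (f x) ^ 2 ∂μ)

/-- The `k`-th Neumann eigenvalue of the Laplacian on `Ω` (with `λ₀ᴺ = 0`), via the
Courant–Fischer min-max over `(k+1)`-dimensional spaces of Lipschitz functions. -/
noncomputable def mmNeumannEigenvalue {X : Type} [MetricSpace X] [MeasurableSpace X] (μ : Measure X)
    (Ω : Set X) (k : ℕ) : ℝ :=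
  sInf {c : ℝ | ∃ u : Fin (k + 1) → (X → ℝ),
    (∀ i, ∃ K : NNReal, LipschitzWith K (u i)) ∧ LinearIndependent ℝ u ∧
    c = sSup (mmRayleigh μ Ω '' {v | v ∈ Submodule.span ℝ (Set.range u) ∧ v ≠ 0})}

/-- Volume of the Euclidean unit ball in ℝⁿ. -/
noncomputable def euclideanUnitBallVolume (n : ℕ) : ℝ :=
  (volume (Metric.closedBall (0 : EuclideanSpace ℝ (Fin n)) 1)).toReal

/-- Encoding of "`(X, dist, μ)` is (the metric measure space of) an `n`-dimensional
complete Riemannian manifold of nonnegative Ricci curvature": a geodesic metric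
measure space satisfying the Bishop–Gromov and Bishop volume inequalities of
dimension `n`. (Mathlib has no Riemannian curvature; `Ric ≥ 0` enters the paper's
proofs only through these volume comparison inequalities.) -/
structure IsNonnegRicciMM (n : ℕ) (X : Type) [MetricSpace X] [MeasurableSpace X] (μ : Measure X) : Prop where
  geodesic : ∀ x y : X, ∀ t : ℝ, 0 ≤ t → t ≤ 1 →
    ∃ z : X, dist x z = t * dist x y ∧ dist z y = (1 - t) * dist x y
  bishopGromov : ∀ (x : X) (r R : ℝ), 0 < r → r ≤ R →
    ENNReal.ofReal ((r / R) ^ n) * μ (Metric.closedBall x R) ≤ μ (Metric.closedBall x r)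
  bishop : ∀ (x : X) (R : ℝ), 0 < R →
    μ (Metric.closedBall x R) ≤
      volume (Metric.closedBall (0 : EuclideanSpace ℝ (Fin n)) 1) * ENNReal.ofReal (R ^ n)

theorem gamma_lower (s : ℝ) (hs : 0 < s) : s ^ s * Real.exp (-s) ≤ Real.Gamma (s + 1) := by
  rw [Real.Gamma_eq_integral (by linarith), ← integral_exp_neg_Ioi s, ← integral_const_mul]
  have hc := Real.GammaIntegral_convergent (s := s + 1) (by linarith)
  refine le_trans ?_ (setIntegral_mono_set hc ?_
    (LE.le.eventuallyLE (Ioi_subset_Ioi hs.le : Ioi s ⊆ Ioi 0)))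
  · refine setIntegral_mono_on ((integrableOn_exp_neg_Ioi s).const_mul _)
      (hc.mono_set (Ioi_subset_Ioi hs.le)) measurableSet_Ioi ?_
    intro x hx
    have hx : s < x := hx
    have : s ^ s ≤ x ^ s := Real.rpow_le_rpow hs.le hx.le hs.le
    simp only [add_sub_cancel_right]
    rw [mul_comm]
    gcongr
  · filter_upwards [ae_restrict_mem measurableSet_Ioi] with x hx
    have hx : 0 < x := hx
    simp only [Pi.zero_apply]
    positivity

theorem unitBall_pos (n : ℕ) : 0 < euclideanUnitBallVolume n := by
  unfold euclideanUnitBallVolume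
  refine ENNReal.toReal_pos ?_ ?_
  · exact (measure_closedBall_pos _ _ one_pos).ne'
  · exact (isCompact_closedBall _ _).measure_lt_top.ne

theorem unitBall_sq (n : ℕ) (hn : 0 < n) :
    (n : ℝ) ^ n * euclideanUnitBallVolume n ^ 2 < 18 ^ n := by
  have : Nonempty (Fin n) := ⟨⟨0, hn⟩⟩
  have hn' : (0 : ℝ) < n := by exact_mod_cast hn
  set s : ℝ := (n : ℝ) / 2 with hs
  have hs0 : 0 < s := by positivity
  have hG := gamma_lower s hs0
  have hlow : 0 < s ^ s * Real.exp (-s) := by positivity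
  have hGpos : 0 < Real.Gamma (s + 1) := lt_of_lt_of_le hlow hG
  have e : euclideanUnitBallVolume n = √Real.pi ^ n / Real.Gamma (s + 1) := by
    unfold euclideanUnitBallVolume
    rw [EuclideanSpace.volume_closedBall]
    simp only [ENNReal.ofReal_one, one_pow, one_mul, Fintype.card_fin]
    rw [ENNReal.toReal_ofReal]
    positivity
  have e2 : (s ^ s * Real.exp (-s)) ^ 2 = (s * Real.exp (-1)) ^ n := by
    rw [mul_pow, mul_pow]
    congr 1
    · rw [← Real.rpow_natCast (s ^ s), ← Real.rpow_mul hs0.le, ← Real.rpow_natCast s]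
      congr 1
      rw [hs]; push_cast; ring
    · rw [← Real.exp_nat_mul, ← Real.exp_nat_mul]
      congr 1
      rw [hs]; push_cast; ring
  have hG2 : (s * Real.exp (-1)) ^ n ≤ Real.Gamma (s + 1) ^ 2 := by
    rw [← e2]; gcongr
  have e3 : (√Real.pi ^ n) ^ 2 = Real.pi ^ n := by
    rw [← pow_mul, mul_comm, pow_mul, Real.sq_sqrt Real.pi_pos.le]
  rw [e, div_pow, e3, ← mul_div_assoc, div_lt_iff₀ (by positivity)]
  refine lt_of_lt_of_le ?_ (mul_le_mul_of_nonneg_left hG2 (by positivity))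
  rw [← mul_pow, ← mul_pow]
  refine pow_lt_pow_left₀ ?_ (by positivity) hn.ne'
  have h1 : Real.pi < 3.15 := Real.pi_lt_d2
  have h2 : Real.exp 1 < 2.7182818286 := Real.exp_one_lt_d9
  have h3 : Real.exp (-1) * Real.exp 1 = 1 := by rw [← Real.exp_add]; simp
  have h4 : 0.36 < Real.exp (-1) := by
    by_contra h
    have : Real.exp (-1) * Real.exp 1 ≤ 0.36 * 2.7182818286 :=
      mul_le_mul (not_lt.1 h) h2.le (Real.exp_pos _).le (by norm_num)
    norm_num [h3] at this
  have : Real.pi < 9 * Real.exp (-1) := by norm_num at *; linarith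
  calc (n : ℝ) * Real.pi < n * (9 * Real.exp (-1)) := by gcongr
    _ = 18 * (s * Real.exp (-1)) := by rw [hs]; ring

theorem localSlope_sq_le {X : Type} [MetricSpace X] (f : X → ℝ) (x : X) (c : ℝ) (hc : 0 ≤ c)
    (h : ∀ᶠ y in nhds x, |f y - f x| ≤ c * dist y x) : (localSlope f x) ^ 2 ≤ c ^ 2 := by
  unfold localSlope
  rcases (nhdsWithin x {x}ᶜ).eq_or_neBot with hb | hb
  · rw [hb]
    have : Filter.limsup (fun y => |f y - f x| / dist y x) (⊥ : Filter X) = 0 := by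
      simp [Filter.limsup_eq]
    rw [this]; nlinarith
  have hle : ∀ᶠ y in nhdsWithin x {x}ᶜ, |f y - f x| / dist y x ≤ c := by
    filter_upwards [nhdsWithin_le_nhds h] with y hy
    exact div_le_of_le_mul₀ dist_nonneg hc hy
  have hge : ∀ y, 0 ≤ |f y - f x| / dist y x := fun y => by positivity
  have hbd : Filter.IsBoundedUnder (· ≤ ·) (nhdsWithin x {x}ᶜ)
      (fun y => |f y - f x| / dist y x) := ⟨c, by simpa using hle⟩
  have hbd' : Filter.IsBoundedUnder (· ≥ ·) (nhdsWithin x {x}ᶜ)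
      (fun y => |f y - f x| / dist y x) := ⟨0, by simpa using Filter.Eventually.of_forall hge⟩
  have h1 := Filter.limsup_le_of_le hbd'.isCoboundedUnder_le hle
  have h2 := Filter.le_limsup_of_frequently_le
    (Filter.Eventually.of_forall hge : ∀ᶠ y in nhdsWithin x {x}ᶜ, _).frequently hbd
  exact pow_le_pow_left₀ h2 h1 2

theorem mmRayleigh_nonneg {X : Type} [MetricSpace X] [MeasurableSpace X] (μ : Measure X)
    (f : X → ℝ) : 0 ≤ mmRayleigh μ Set.univ f :=
  div_nonneg (integral_nonneg fun _ => sq_nonneg _) (integral_nonneg fun _ => sq_nonneg _)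

theorem eig_le {X : Type} [MetricSpace X] [MeasurableSpace X] (μ : Measure X) (k : ℕ)
    (u : Fin (k + 1) → X → ℝ) (p : Fin (k + 1) → X)
    (hL : ∀ i, ∃ K : NNReal, LipschitzWith K (u i))
    (h0 : ∀ i j, i ≠ j → u i (p j) = 0) (h1 : ∀ i, u i (p i) ≠ 0) (b : ℝ) (hb : 0 ≤ b)
    (hR : ∀ a : Fin (k + 1) → ℝ, a ≠ 0 → mmRayleigh μ Set.univ (fun x => ∑ i, a i * u i x) ≤ b) :
    mmNeumannEigenvalue μ Set.univ k ≤ b := by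
  unfold mmNeumannEigenvalue
  have hbdd : BddBelow {c : ℝ | ∃ u : Fin (k + 1) → (X → ℝ),
    (∀ i, ∃ K : NNReal, LipschitzWith K (u i)) ∧ LinearIndependent ℝ u ∧
    c = sSup (mmRayleigh μ Set.univ '' {v | v ∈ Submodule.span ℝ (Set.range u) ∧ v ≠ 0})} := by
    refine ⟨0, ?_⟩
    rintro c ⟨u, -, -, rfl⟩
    refine Real.sSup_nonneg ?_
    rintro _ ⟨v, -, rfl⟩
    exact mmRayleigh_nonneg μ v
  refine (csInf_le hbdd ⟨u, hL, ?_, rfl⟩).trans ?_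
  · rw [Fintype.linearIndependent_iff]
    intro g hg i
    have := congrFun hg (p i)
    simp only [Finset.sum_apply, Pi.smul_apply, smul_eq_mul, Pi.zero_apply] at this
    rw [Finset.sum_eq_single i (fun j _ hj => by rw [h0 j i hj, mul_zero])
      (fun h => absurd (Finset.mem_univ i) h)] at this
    exact (mul_eq_zero.1 this).resolve_right (h1 i)
  · refine Real.sSup_le ?_ hb
    rintro _ ⟨v, ⟨hv, hv0⟩, rfl⟩
    obtain ⟨a, rfl⟩ := (Submodule.mem_span_range_iff_exists_fun ℝ).1 hv
    have e : (∑ i, a i • u i) = fun x => ∑ i, a i * u i x := by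
      ext x; simp [Finset.sum_apply]
    rw [e]
    refine hR a ?_
    rintro rfl
    exact hv0 (by simp)

/-- Points not distinguished by the continuous a.e.-measurable functions. -/
def indist {X : Type} [MetricSpace X] [MeasurableSpace X] (μ : Measure X) : Setoid X where
  r x y := ∀ f : X → ℝ, Continuous f → AEMeasurable f μ → f x = f y
  iseqv := ⟨fun _ _ _ _ => rfl, fun h f hf hm => (h f hf hm).symm,
    fun h h' f hf hm => (h f hf hm).trans (h' f hf hm)⟩

/-- A representative of the class of `x`. -/
noncomputable def rep {X : Type} [MetricSpace X] [MeasurableSpace X] (μ : Measure X) (x : X) : X :=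
  (Quotient.mk (indist μ) x).out

theorem rep_rel {X : Type} [MetricSpace X] [MeasurableSpace X] (μ : Measure X) (x : X) :
    (indist μ).r (rep μ x) x := Quotient.mk_out (s := indist μ) x

theorem rep_rep {X : Type} [MetricSpace X] [MeasurableSpace X] (μ : Measure X) (x y : X)
    (h : (indist μ).r x y) : rep μ x = rep μ y := by
  unfold rep
  rw [Quotient.sound (s := indist μ) h]

theorem nullMeas_of_sep {X : Type} [MetricSpace X] [MeasurableSpace X] [CompactSpace X]
    (μ : Measure X) (K : Set X) (hK : IsClosed K)
    (hsep : ∀ x ∈ K, ∀ y ∉ K, ¬ (indist μ).r x y) : NullMeasurableSet K μ := by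
  have key : ∀ y ∈ Kᶜ, ∃ O : Set X, IsOpen O ∧ NullMeasurableSet O μ ∧ y ∈ O ∧ Disjoint O K := by
    intro y hy
    refine hK.isCompact.induction_on
      (p := fun K => ∃ O : Set X, IsOpen O ∧ NullMeasurableSet O μ ∧ y ∈ O ∧ Disjoint O K)
      ⟨univ, isOpen_univ, nullMeasurableSet_univ, mem_univ _, disjoint_empty _⟩ ?_ ?_ ?_
    · rintro s t hst ⟨O, h1, h2, h3, h4⟩
      exact ⟨O, h1, h2, h3, h4.mono_right hst⟩
    · rintro s t ⟨O, h1, h2, h3, h4⟩ ⟨O', h1', h2', h3', h4'⟩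
      exact ⟨O ∩ O', h1.inter h1', h2.inter h2', ⟨h3, h3'⟩,
        disjoint_union_right.2 ⟨h4.mono_left inter_subset_left, h4'.mono_left inter_subset_right⟩⟩
    · intro x hx
      have hxy := hsep x hx y hy
      have : ∃ f : X → ℝ, Continuous f ∧ AEMeasurable f μ ∧ f x ≠ f y := by
        by_contra hcon
        push Not at hcon
        exact hxy hcon
      obtain ⟨f, hf, hm, hne⟩ := this
      obtain ⟨U, V, hU, hV, hxU, hyV, hUV⟩ := t2_separation hne
      refine ⟨f ⁻¹' U, mem_nhdsWithin_of_mem_nhds ((hU.preimage hf).mem_nhds hxU), f ⁻¹' V,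
        hV.preimage hf, hm.nullMeasurable hV.measurableSet, hyV, ?_⟩
      exact (hUV.preimage f).symm
  choose! O hO hOm hyO hd using key
  obtain ⟨T, hTK, hT, hTU⟩ := TopologicalSpace.isOpen_biUnion_countable Kᶜ O hO
  have e : Kᶜ = ⋃ i ∈ T, O i := by
    rw [hTU]
    ext y
    simp only [mem_iUnion]
    constructor
    · intro hy
      exact ⟨y, hy, hyO y hy⟩
    · rintro ⟨z, hz, hyz⟩ hyK
      exact (disjoint_left.1 (hd z hz)) hyz hyK
  have : NullMeasurableSet Kᶜ μ := by
    rw [e]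
    exact NullMeasurableSet.biUnion hT (fun i hi => hOm i (hTK hi))
  exact this.of_compl

theorem eig_le_of_infinite {X : Type} [MetricSpace X] [MeasurableSpace X] (μ : Measure X)
    (k : ℕ) (hinf : {x | x ≠ rep μ x}.Infinite) : mmNeumannEigenvalue μ Set.univ k ≤ 0 := by
  let e := hinf.natEmbedding
  let p : Fin (k + 1) → X := fun i => (e i : X)
  have hp : Function.Injective p := fun i j h => Fin.ext (e.injective (Subtype.ext h))
  have hpr : ∀ i, p i ≠ rep μ (p i) := fun i => (e i).2
  have hpr' : ∀ i j, rep μ (p i) ≠ p j := by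
    intro i j h
    apply hpr j
    rw [← h]
    exact (rep_rep μ _ _ (rep_rel μ (p i))).symm ▸ rfl
  let F : Fin (k + 1) → Set X := fun i => (range p ∪ range (fun i => rep μ (p i))) \ {p i}
  have hF : ∀ i, (F i).Finite := fun i =>
    ((finite_range _).union (finite_range _)).subset sdiff_subset
  have hrF : ∀ i j, rep μ (p j) ∈ F i := fun i j => ⟨Or.inr ⟨j, rfl⟩, hpr' j i⟩
  have hz : ∀ i, ∀ x ∈ F i, infDist x (F i) = 0 := fun i x hx => infDist_zero_of_mem hx
  refine eig_le μ k (fun i x => infDist x (F i)) p (fun i => ⟨1, lipschitz_infDist_pt _⟩) ?_ ?_ 0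
    le_rfl ?_
  · intro i j hij
    exact hz i _ ⟨Or.inl ⟨j, rfl⟩, fun h => hij (hp h).symm⟩
  · intro i
    have := ((hF i).isClosed.notMem_iff_infDist_pos ⟨_, hrF i i⟩ (x := p i)).1 (fun h => h.2 rfl)
    exact this.ne'
  · intro a ha
    unfold mmRayleigh
    have hni : ¬ Integrable (fun x => (∑ i, a i * infDist x (F i)) ^ 2) (μ.restrict univ) := by
      rw [Measure.restrict_univ]
      intro hI
      apply ha
      ext j
      have hc : Continuous (fun x => (∑ i, a i * infDist x (F i)) ^ 2) :=
        (continuous_finsetSum _ fun i _ => continuous_const.mul (continuous_infDist_pt _)).pow 2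
      have h := rep_rel μ (p j) _ hc hI.aestronglyMeasurable.aemeasurable
      simp only [hz _ _ (hrF _ j), mul_zero, Finset.sum_const_zero] at h
      rw [Finset.sum_eq_single j] at h
      · have h' : a j * infDist (p j) (F j) = 0 := by
          have := h.symm
          simpa using this
        have := ((hF j).isClosed.notMem_iff_infDist_pos ⟨_, hrF j j⟩ (x := p j)).1
          (fun h => h.2 rfl)
        exact (mul_eq_zero.1 h').resolve_right this.ne'
      · intro i _ hij
        rw [hz i _ ⟨Or.inl ⟨j, rfl⟩, fun h => hij (hp h).symm⟩, mul_zero]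
      · intro h; exact absurd (Finset.mem_univ j) h
    rw [integral_undef hni, div_zero]

theorem singleton_null {n : ℕ} (hn : 0 < n) {X : Type} [MetricSpace X] [MeasurableSpace X]
    (μ : Measure X) (h : IsNonnegRicciMM n X μ) (x : X) : μ {x} = 0 := by
  have h1 : ∀ R : ℝ, 0 < R → μ {x} ≤
      volume (Metric.closedBall (0 : EuclideanSpace ℝ (Fin n)) 1) * ENNReal.ofReal (R ^ n) :=
    fun R hR => (measure_mono (by simp [hR.le])).trans (h.bishop x R hR)
  have ht : Filter.Tendsto (fun R : ℝ =>
      volume (Metric.closedBall (0 : EuclideanSpace ℝ (Fin n)) 1) * ENNReal.ofReal (R ^ n))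
      (nhdsWithin 0 (Ioi 0)) (nhds 0) := by
    have : Filter.Tendsto (fun R : ℝ => ENNReal.ofReal (R ^ n)) (nhdsWithin 0 (Ioi 0)) (nhds 0) := by
      have h2 : Continuous (fun R : ℝ => ENNReal.ofReal (R ^ n)) :=
        ENNReal.continuous_ofReal.comp (continuous_pow n)
      have h3 := (h2.tendsto 0).mono_left (nhdsWithin_le_nhds (s := Ioi (0 : ℝ)))
      simpa [zero_pow hn.ne'] using h3
    have h4 := ENNReal.Tendsto.const_mul
      (a := volume (Metric.closedBall (0 : EuclideanSpace ℝ (Fin n)) 1)) this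
      (Or.inr (isCompact_closedBall _ _).measure_lt_top.ne)
    simpa using h4
  refine le_antisymm (ge_of_tendsto ht ?_) (zero_le)
  filter_upwards [self_mem_nhdsWithin] with R hR
  exact h1 R hR

theorem nullMeas_closed {n : ℕ} (hn : 0 < n) {X : Type} [MetricSpace X] [MeasurableSpace X]
    [CompactSpace X] (μ : Measure X) (h : IsNonnegRicciMM n X μ)
    (hfin : {x | x ≠ rep μ x}.Finite) (K : Set X) (hK : IsClosed K) : NullMeasurableSet K μ := by
  set D : Set X := {x | x ≠ rep μ x} ∪ rep μ '' {x | x ≠ rep μ x} with hD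
  have hDf : D.Finite := hfin.union (hfin.image _)
  have hD0 : μ D = 0 := by
    rw [← biUnion_of_singleton D]
    exact (measure_biUnion_null_iff hDf.countable).2 fun x _ => singleton_null hn μ h x
  have h1 : NullMeasurableSet (K ∪ D) μ := by
    refine nullMeas_of_sep μ _ (hK.union hDf.isClosed) ?_
    intro x hx y hy hxy
    have hyD : y ∉ D := fun h => hy (Or.inr h)
    have hxy' : x ≠ y := fun h => hy (h ▸ hx)
    have hr := rep_rep μ x y hxy
    have hyr : y = rep μ y := by
      by_contra hc
      exact hyD (Or.inl hc)
    have hxr : x ≠ rep μ x := fun hc => hxy' (by rw [hc, hr, ← hyr])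
    exact hyD (Or.inr ⟨x, hxr, by rw [hr, ← hyr]⟩)
  refine h1.congr ?_
  exact union_ae_eq_left_of_ae_eq_empty (ae_eq_empty.2 hD0)

theorem exists_points {X : Type} [MetricSpace X] [MeasurableSpace X] (μ : Measure X) (r : ℝ)
    (k : ℕ) (b : ENNReal) (hb : ∀ x : X, μ (closedBall x r) ≤ b) (hlt : k * b < μ univ) :
    ∃ p : Fin (k + 1) → X, ∀ i j, i ≠ j → r < dist (p i) (p j) := by
  have : ∀ m, m ≤ k + 1 → ∃ p : Fin m → X, ∀ i j, i ≠ j → r < dist (p i) (p j) := by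
    intro m
    induction m with
    | zero => intro _; exact ⟨Fin.elim0, fun i => i.elim0⟩
    | succ m ih =>
      intro hm
      obtain ⟨p, hp⟩ := ih (by omega)
      have hx : ∃ x : X, ∀ i, r < dist x (p i) := by
        by_contra hcon
        push Not at hcon
        have hsub : (univ : Set X) ⊆ ⋃ i ∈ (Finset.univ : Finset (Fin m)), closedBall (p i) r := by
          intro x _
          obtain ⟨i, hi⟩ := hcon x
          simp only [mem_iUnion]
          exact ⟨i, Finset.mem_univ i, hi⟩
        have h1 := (measure_mono (μ := μ) hsub).trans (measure_biUnion_finset_le _ _)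
        have h2 : ∑ i : Fin m, μ (closedBall (p i) r) ≤ m * b := by
          refine (Finset.sum_le_sum fun i _ => hb (p i)).trans ?_
          simp
        have h3 : (m : ENNReal) * b ≤ k * b := by
          gcongr
          omega
        exact absurd (h1.trans (h2.trans h3)) (not_le.2 hlt)
      obtain ⟨x, hx⟩ := hx
      refine ⟨Fin.cons x p, ?_⟩
      intro i j
      refine Fin.cases ?_ (fun i => ?_) i <;> refine Fin.cases ?_ (fun j => ?_) j
      · intro h; exact absurd rfl h
      · intro _; simpa using hx j
      · intro _; simpa [dist_comm] using hx i
      · intro h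
        simpa using hp i j (fun h' => h (by rw [h']))
  exact this (k + 1) le_rfl

/-- Bump function around `p`. -/
noncomputable def bump {X : Type} [MetricSpace X] (L ρ : ℝ) (p x : X) : ℝ :=
  max 0 (min 1 (L * (ρ - dist x p)))

theorem bump_lip {X : Type} [MetricSpace X] (L ρ : ℝ) (hL : 0 ≤ L) (p x y : X) :
    |bump L ρ p x - bump L ρ p y| ≤ L * dist x y := by
  unfold bump
  have h1 := abs_max_sub_max_le_max 0 (min 1 (L * (ρ - dist x p))) 0 (min 1 (L * (ρ - dist y p)))
  have h2 := abs_min_sub_min_le_max 1 (L * (ρ - dist x p)) 1 (L * (ρ - dist y p))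
  rw [sub_self, abs_zero] at h1 h2
  refine h1.trans (max_le (by positivity) (h2.trans (max_le (by positivity) ?_)))
  have : L * (ρ - dist x p) - L * (ρ - dist y p) = L * (dist y p - dist x p) := by ring
  rw [this, abs_mul, abs_of_nonneg hL, dist_comm x y]
  gcongr
  exact abs_dist_sub_le y x p

theorem bump_zero {X : Type} [MetricSpace X] (L ρ : ℝ) (hL : 0 ≤ L) (p x : X)
    (h : ρ ≤ dist x p) : bump L ρ p x = 0 := by
  unfold bump
  refine max_eq_left ((min_le_right _ _).trans ?_)
  exact mul_nonpos_of_nonneg_of_nonpos hL (by linarith)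

theorem bump_one {X : Type} [MetricSpace X] (L ρ : ℝ) (p x : X)
    (h : 1 ≤ L * (ρ - dist x p)) : bump L ρ p x = 1 := by
  unfold bump
  rw [min_eq_left h]; simp

theorem rayleigh_bump {X : Type} [MetricSpace X] [MeasurableSpace X] (μ : Measure X)
    [IsFiniteMeasure μ] (hm : ∀ K : Set X, IsClosed K → NullMeasurableSet K μ)
    (k : ℕ) (p : Fin (k + 1) → X) (L ρ ρ' c : ℝ) (hL : 0 ≤ L) (hρ : 0 < ρ) (hc : 0 ≤ c)
    (hρ' : 1 ≤ L * (ρ - ρ')) (hρρ : ρ' ≤ ρ)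
    (hp : ∀ i j, i ≠ j → 3 * ρ < dist (p i) (p j))
    (hμ : ∀ x, μ.real (closedBall x ρ) ≤ c * μ.real (closedBall x ρ'))
    (a : Fin (k + 1) → ℝ) :
    mmRayleigh μ Set.univ (fun x => ∑ i, a i * bump L ρ (p i) x) ≤ c * L ^ 2 := by
  unfold mmRayleigh
  rw [Measure.restrict_univ]
  set v : X → ℝ := fun x => ∑ i, a i * bump L ρ (p i) x with hv
  by_cases hI : Integrable (fun x => v x ^ 2) μ
  swap
  · rw [integral_undef hI, div_zero]; positivity
  have hsep : ∀ i j, i ≠ j → ∀ x y, dist x (p i) ≤ ρ → dist y x ≤ ρ → ρ ≤ dist y (p j) := by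
    intro i j hij x y hx hyx
    have h1 := hp i j hij
    have h2 := dist_triangle (p i) x (p j)
    have h3 := dist_triangle x y (p j)
    rw [dist_comm (p i) x] at h2
    rw [dist_comm x y] at h3
    linarith
  have hveq : ∀ i x y, dist x (p i) ≤ ρ → dist y x ≤ ρ → v y = a i * bump L ρ (p i) y := by
    intro i x y hx hyx
    rw [hv]
    refine Finset.sum_eq_single i (fun j _ hj => ?_) (fun h => absurd (Finset.mem_univ i) h)
    rw [bump_zero L ρ hL _ _ (hsep i j hj.symm x y hx hyx), mul_zero]
  -- indicator sums
  have hsum : ∀ (s : ℝ), s ≤ ρ → ∀ (d : Fin (k + 1) → ℝ) i x, dist x (p i) ≤ s →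
      ∑ j, (closedBall (p j) s).indicator (fun _ => d j) x = d i := by
    intro s hs d i x hx
    rw [Finset.sum_eq_single i]
    · exact indicator_of_mem (by exact hx) _
    · intro j _ hj
      refine indicator_of_notMem ?_ _
      intro hxj
      have hxj : dist x (p j) ≤ s := hxj
      have h1 := hp i j hj.symm
      have h2 := dist_triangle_left (p i) (p j) x
      linarith
    · intro h; exact absurd (Finset.mem_univ i) h
  have hsum0 : ∀ (s : ℝ) (d : Fin (k + 1) → ℝ) x, (∀ i, ¬ dist x (p i) ≤ s) →
      ∑ j, (closedBall (p j) s).indicator (fun _ => d j) x = 0 := by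
    intro s d x hx
    refine Finset.sum_eq_zero fun j _ => indicator_of_notMem ?_ _
    exact hx j
  have hint : ∀ (s : ℝ) (d : Fin (k + 1) → ℝ) (j : Fin (k + 1)),
      Integrable ((closedBall (p j) s).indicator (fun _ => d j)) μ := by
    intro s d j
    exact (integrable_const _).indicator₀ (hm _ isClosed_closedBall)
  have hintsum : ∀ (s : ℝ) (d : Fin (k + 1) → ℝ),
      ∫ x, ∑ j, (closedBall (p j) s).indicator (fun _ => d j) x ∂μ
        = ∑ j, μ.real (closedBall (p j) s) * d j := by
    intro s d
    rw [integral_finsetSum _ fun j _ => hint s d j]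
    refine Finset.sum_congr rfl fun j _ => ?_
    rw [integral_indicator₀ (hm _ isClosed_closedBall), setIntegral_const, smul_eq_mul]
  have hnum : ∫ x, localSlope v x ^ 2 ∂μ ≤ ∑ j, μ.real (closedBall (p j) ρ) * (a j ^ 2 * L ^ 2) := by
    rw [← hintsum ρ (fun j => a j ^ 2 * L ^ 2)]
    refine integral_mono_of_nonneg (Filter.Eventually.of_forall fun x => sq_nonneg _)
      (integrable_finsetSum _ fun j _ => hint ρ (fun j => a j ^ 2 * L ^ 2) j)
      (Filter.Eventually.of_forall fun x => ?_)
    by_cases hx : ∃ i, dist x (p i) ≤ ρ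
    · obtain ⟨i, hi⟩ := hx
      simp only
      rw [hsum ρ le_rfl (fun j => a j ^ 2 * L ^ 2) i x hi]
      have := localSlope_sq_le v x (|a i| * L) (by positivity) (by
        filter_upwards [Metric.ball_mem_nhds x hρ] with y hy
        rw [hveq i x y hi (le_of_lt hy), hveq i x x hi (by simp [hρ.le]), ← mul_sub, abs_mul,
          mul_assoc]
        gcongr
        exact bump_lip L ρ hL _ _ _)
      rwa [mul_pow, sq_abs] at this
    · push Not at hx
      simp only
      rw [hsum0 ρ _ x (fun i => not_le.2 (hx i))]
      have := localSlope_sq_le v x 0 le_rfl (by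
        have hev : ∀ᶠ y in nhds x, ∀ i, ρ < dist y (p i) := by
          rw [Filter.eventually_all]
          intro i
          exact (continuous_id.dist continuous_const).continuousAt.eventually_const_lt (hx i)
        have hz : ∀ y, (∀ i, ρ < dist y (p i)) → v y = 0 := fun y hy =>
          Finset.sum_eq_zero fun i _ => by rw [bump_zero L ρ hL _ _ (hy i).le, mul_zero]
        filter_upwards [hev] with y hy
        rw [hz y hy, hz x hx]; simp)
      simpa using this
  have hden : ∑ j, μ.real (closedBall (p j) ρ') * a j ^ 2 ≤ ∫ x, v x ^ 2 ∂μ := by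
    rw [← hintsum ρ' (fun j => a j ^ 2)]
    refine integral_mono (integrable_finsetSum _ fun j _ => hint ρ' (fun j => a j ^ 2) j) hI
      (fun x => ?_)
    by_cases hx : ∃ i, dist x (p i) ≤ ρ'
    · obtain ⟨i, hi⟩ := hx
      simp only
      rw [hsum ρ' hρρ (fun j => a j ^ 2) i x hi, hveq i x x (hi.trans hρρ) (by simp [hρ.le]),
        bump_one L ρ, mul_one]
      refine hρ'.trans ?_
      gcongr
    · push Not at hx
      simp only
      rw [hsum0 ρ' _ x (fun i => not_le.2 (hx i))]
      positivity
  refine div_le_of_le_mul₀ (integral_nonneg fun _ => sq_nonneg _) (by positivity) ?_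
  refine hnum.trans (le_trans ?_ (mul_le_mul_of_nonneg_left hden (by positivity)))
  rw [Finset.mul_sum]
  refine Finset.sum_le_sum fun j _ => ?_
  have := mul_le_mul_of_nonneg_right (hμ (p j)) (by positivity : 0 ≤ a j ^ 2 * L ^ 2)
  linarith

/-- Pólya-type bound for closed manifolds: for an `n`-dimensional closed Riemannian
manifold `M` of nonnegative Ricci curvature, `λ_k(M) ≤ C (k/(ωₙ vol M))^(2/n)` for
an absolute constant `C`. -/
theorem polya_bound_closed_manifold :
    ∃ C : ℝ, 0 < C ∧ ∀ (n : ℕ), 0 < n →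
      ∀ (X : Type) [MetricSpace X] [MeasurableSpace X] (μ : Measure X),
      CompactSpace X → Nonempty X → IsNonnegRicciMM n X μ →
      μ Set.univ ≠ 0 → μ Set.univ ≠ ⊤ →
      ∀ (k : ℕ), 1 ≤ k →
      mmNeumannEigenvalue μ Set.univ k ≤
        C * ((k : ℝ) / (euclideanUnitBallVolume n * (μ Set.univ).toReal)) ^ ((2 : ℝ) / n) := by
  refine ⟨40000, by norm_num, ?_⟩
  intro n hn X _ _ μ _ _ h hV0 hVt k hk
  have hn' : (1 : ℝ) ≤ n := by exact_mod_cast hn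
  have hn0 : (n : ℝ) ≠ 0 := by positivity
  have hk' : (1 : ℝ) ≤ k := by exact_mod_cast hk
  have : IsFiniteMeasure μ := ⟨lt_top_iff_ne_top.2 hVt⟩
  set V : ℝ := (μ Set.univ).toReal with hVdef
  have hV : 0 < V := ENNReal.toReal_pos hV0 hVt
  set w : ℝ := euclideanUnitBallVolume n with hwdef
  have hw : 0 < w := unitBall_pos n
  by_cases hfin : {x | x ≠ rep μ x}.Finite
  swap
  · refine (eig_le_of_infinite μ k hfin).trans ?_
    positivity
  have hm := nullMeas_closed hn μ h hfin
  set q : ℝ := (k : ℝ) / (w * V) with hq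
  have hq0 : 0 < q := by positivity
  set t : ℝ := q ^ ((1 : ℝ) / n) with ht
  have ht0 : 0 < t := Real.rpow_pos_of_pos hq0 _
  have htn : t ^ n = q := by
    rw [ht, ← Real.rpow_natCast, ← Real.rpow_mul hq0.le, one_div, inv_mul_cancel₀ hn0, Real.rpow_one]
  have ht2 : q ^ ((2 : ℝ) / n) = t ^ 2 := by
    rw [ht, ← Real.rpow_natCast, ← Real.rpow_mul hq0.le]
    congr 1
    push_cast; ring
  rw [ht2]
  set r : ℝ := n / (18 * t) with hr
  have hr0 : 0 < r := by positivity
  have hrn : k * (w * r ^ n) < V := by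
    have h1 := unitBall_sq n hn
    have h2 : k * (w * r ^ n) = V * ((n : ℝ) ^ n * w ^ 2 / 18 ^ n) := by
      rw [hr, div_pow, mul_pow, htn, hq]
      field_simp
    rw [h2]
    have h3 : (n : ℝ) ^ n * w ^ 2 / 18 ^ n < 1 := by
      rw [div_lt_one (by positivity)]; exact h1
    calc V * _ < V * 1 := by gcongr
      _ = V := mul_one V
  have hwE : volume (Metric.closedBall (0 : EuclideanSpace ℝ (Fin n)) 1) = ENNReal.ofReal w := by
    rw [hwdef]
    unfold euclideanUnitBallVolume
    rw [ENNReal.ofReal_toReal (isCompact_closedBall _ _).measure_lt_top.ne]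
  obtain ⟨p, hp⟩ := exists_points μ r k (ENNReal.ofReal (w * r ^ n)) (by
      intro x
      have := h.bishop x r hr0
      rwa [hwE, ← ENNReal.ofReal_mul hw.le] at this) (by
      rw [← ENNReal.ofReal_natCast, ← ENNReal.ofReal_mul (by positivity),
        ← ENNReal.ofReal_toReal hVt]
      exact (ENNReal.ofReal_lt_ofReal_iff hV).2 hrn)
  set ρ : ℝ := r / 3 with hρ
  have hρ0 : 0 < ρ := by positivity
  set L : ℝ := (n + 1) / ρ with hL
  have hL0 : 0 < L := by positivity
  set ρ' : ℝ := n / (n + 1) * ρ with hρ'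
  have hρ'0 : 0 < ρ' := by positivity
  have hρρ : ρ' ≤ ρ := by
    rw [hρ']
    refine mul_le_of_le_one_left hρ0.le ?_
    rw [div_le_one (by positivity)]; linarith
  have hLρ : L * (ρ - ρ') = 1 := by
    rw [hL, hρ']; field_simp; ring
  have hpow : 1 ≤ 3 * ((n : ℝ) / (n + 1)) ^ n := by
    have h1 : (1 + 1 / (n : ℝ)) ^ n ≤ Real.exp 1 := by
      have := Real.add_one_le_exp (1 / (n : ℝ))
      calc (1 + 1 / (n : ℝ)) ^ n ≤ (Real.exp (1 / (n : ℝ))) ^ n := by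
            gcongr; linarith
        _ = Real.exp 1 := by
            rw [← Real.exp_nat_mul]; congr 1; field_simp
    have h2 : Real.exp 1 < 3 := Real.exp_one_lt_d9.trans (by norm_num)
    have h3 : (1 + 1 / (n : ℝ)) ^ n * ((n : ℝ) / (n + 1)) ^ n = 1 := by
      rw [← mul_pow]
      have : (1 + 1 / (n : ℝ)) * ((n : ℝ) / (n + 1)) = 1 := by field_simp
      rw [this, one_pow]
    refine h3.symm.le.trans ?_
    exact mul_le_mul_of_nonneg_right (h1.trans h2.le) (by positivity)
  have hμ : ∀ x, μ.real (closedBall x ρ) ≤ 3 * μ.real (closedBall x ρ') := by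
    intro x
    have h1 := h.bishopGromov x ρ' ρ hρ'0 hρρ
    have h2 : ρ' / ρ = (n : ℝ) / (n + 1) := by rw [hρ']; field_simp
    rw [h2] at h1
    have h3 := ENNReal.toReal_mono (measure_ne_top μ _) h1
    rw [ENNReal.toReal_mul, ENNReal.toReal_ofReal (by positivity)] at h3
    change _ * μ.real _ ≤ μ.real _ at h3
    have h4 : 0 ≤ μ.real (closedBall x ρ) := measureReal_nonneg
    nlinarith
  have hb : 3 * L ^ 2 ≤ 40000 * t ^ 2 := by
    have e : L = 54 * t * ((n + 1) / n) := by
      rw [hL, hρ, hr]; field_simp; ring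
    have h1 : ((n : ℝ) + 1) / n ≤ 2 := by
      rw [div_le_iff₀ (by positivity)]; linarith
    have h2 : L ≤ 108 * t := by
      rw [e]
      calc 54 * t * (((n : ℝ) + 1) / n) ≤ 54 * t * 2 := by gcongr
        _ = 108 * t := by ring
    have h3 : L ^ 2 ≤ (108 * t) ^ 2 := by gcongr
    nlinarith [sq_nonneg t]
  have hp3 : ∀ i j, i ≠ j → 3 * ρ < dist (p i) (p j) := by
    intro i j hij
    have := hp i j hij
    rw [hρ]; linarith
  refine (eig_le μ k (fun i => bump L ρ (p i)) p ?_ ?_ ?_ (3 * L ^ 2) (by positivity) ?_).trans hb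
  · intro i
    refine ⟨L.toNNReal, LipschitzWith.of_dist_le_mul fun x y => ?_⟩
    rw [Real.dist_eq, Real.coe_toNNReal _ hL0.le]
    exact bump_lip L ρ hL0.le _ _ _
  · intro i j hij
    refine bump_zero L ρ hL0.le _ _ ?_
    have := hp3 j i hij.symm
    linarith
  · intro i
    rw [bump_one L ρ]
    · exact one_ne_zero
    · rw [dist_self]
      calc 1 = L * (ρ - ρ') := hLρ.symm
        _ ≤ L * (ρ - 0) := by gcongr
  · intro a _
    exact rayleigh_bump μ hm k p L ρ ρ' 3 hL0.le hρ0 (by norm_num) hLρ.ge hρρ hp3 hμ a
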